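/- arXiv:2407.15743 — 2 statements merged into one kernel-verified Lean document; each statement's English description precedes it below -/
import Mathlib

section
/- Let t and Ω be natural numbers with t + 1 ≤ Ω. Set g = gcd(Ω, t+1), β₀ = (t+1)/g, B₀ = Ω/g, and S₀ = C(Ω, t+1)/B₀. Then the family of all (t+1)-element subsets of a ground set with Ω elements (e.g., Fin Ω) can be partitioned into S₀ pairwise disjoint subfamilies S(1), …, S(S₀) such that: (i) each subfamily S(s) contains exactly B₀ sets, and (ii) for every s and every element x of the ground set, x belongs to exactly β₀ of the sets in S(s). -/
open Finset

/-- A nonnegative integer matrix with constant row sums `N` and column sums `N * cap c` supports an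
assignment of rows to columns in which column `c` is used exactly `cap c` times. -/
theorem exists_assignment_of_row_sum_col_sum {α γ : Type*} [Fintype α] [Fintype γ]
    [DecidableEq γ] (u : α → γ → ℕ) (cap : γ → ℕ) {N : ℕ} (hN : 0 < N)
    (row : ∀ a, ∑ c, u a c = N) (col : ∀ c, ∑ a, u a c = N * cap c) :
    ∃ f : α → γ, (∀ a, u a (f a) ≠ 0) ∧ ∀ c, #{a | f a = c} = cap c := by
  classical
  have hall : ∀ A : Finset α,
      #A ≤ #(A.biUnion fun a => ({p | u a p.1 ≠ 0} : Finset (Σ c, Fin (cap c)))) := by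
    intro A
    set M : Finset γ := {c | ∃ a ∈ A, u a c ≠ 0} with hM
    have hslots : (A.biUnion fun a => ({p | u a p.1 ≠ 0} : Finset (Σ c, Fin (cap c))))
        = M.sigma fun _ => univ := by
      ext p
      simp [hM]
    rw [hslots, card_sigma]
    simp only [card_univ, Fintype.card_fin]
    refine Nat.le_of_mul_le_mul_left ?_ hN
    calc N * #A = ∑ a ∈ A, ∑ c, u a c := by simp [row, mul_comm]
      _ = ∑ a ∈ A, ∑ c ∈ M, u a c := by
          refine sum_congr rfl fun a ha => (sum_subset (subset_univ _) fun c _ hc => ?_).symm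
          by_contra hne
          exact hc (by simpa [hM] using ⟨a, ha, hne⟩)
      _ = ∑ c ∈ M, ∑ a ∈ A, u a c := sum_comm
      _ ≤ ∑ c ∈ M, ∑ a, u a c :=
          sum_le_sum fun c _ => sum_le_sum_of_subset (subset_univ A)
      _ = N * ∑ c ∈ M, cap c := by simp [col, mul_sum]
  obtain ⟨e, he, hmem⟩ := (all_card_le_biUnion_card_iff_exists_injective _).1 hall
  refine ⟨fun a => (e a).1, fun a => by simpa using hmem a, ?_⟩
  have hle : ∀ c ∈ (univ : Finset γ), #{a | (e a).1 = c} ≤ cap c := by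
    intro c _
    have : #{a | (e a).1 = c} ≤ #(({c} : Finset γ).sigma fun c => (univ : Finset (Fin (cap c)))) :=
      card_le_card_of_injOn e (fun a ha => by simpa using ha) he.injOn
    simpa using this
  have hsum : ∑ c, #{a | (e a).1 = c} = ∑ c, cap c := by
    refine Nat.eq_of_mul_eq_mul_left hN ?_
    rw [← card_eq_sum_card_fiberwise (fun a _ => mem_univ _), mul_sum]
    simp_rw [← col]
    rw [sum_comm]
    simp [row, mul_comm]
  exact fun c => (sum_eq_sum_iff_of_le hle).1 hsum c (mem_univ c)

/-- Two functions on a finite type with fibers of equal sizes differ by a permutation. -/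
theorem exists_perm_of_card_fiber_eq {α β : Type*} [Fintype α] [DecidableEq β] (g h : α → β)
    (hgh : ∀ b, #{a | g a = b} = #{a | h a = b}) :
    ∃ π : Equiv.Perm α, ∀ a, h (π a) = g a := by
  have e : ∀ b, Nonempty ({a // g a = b} ≃ {a // h a = b}) := fun b =>
    ⟨Fintype.equivOfCardEq (by simpa [Fintype.card_subtype] using hgh b)⟩
  refine ⟨(Equiv.sigmaFiberEquiv g).symm.trans ((Equiv.sigmaCongrRight fun b => (e b).some).trans
    (Equiv.sigmaFiberEquiv h)), fun a => ?_⟩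
  exact ((e (g a)).some ⟨a, rfl⟩).2

section Baranyai

variable {V : Type*} [Fintype V] [DecidableEq V] {k : ℕ}

/-- The number of `k`-sets with prescribed trace on `X` avoiding a point outside `X` does not
depend on the point. -/
theorem card_filter_trace_notMem_eq (X A : Finset V) {a y : V} (ha : a ∉ X) (hy : y ∉ X) :
    #{T : {T : Finset V // #T = k} | T.1 ∩ X = A ∧ y ∉ T.1}
      = #{T : {T : Finset V // #T = k} | T.1 ∩ X = A ∧ a ∉ T.1} := by
  let σ : {T : Finset V // #T = k} ≃ {T : Finset V // #T = k} :=
    (Equiv.swap y a).finsetCongr.subtypeEquiv fun T => by simp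
  have hmem : ∀ T x, x ∈ (σ T).1 ↔ Equiv.swap y a x ∈ T.1 := fun T x => by
    simp [σ, Finset.mem_map_equiv]
  refine card_equiv σ fun T => ?_
  have htrace : (σ T).1 ∩ X = T.1 ∩ X := by
    ext x
    simp only [mem_inter, hmem]
    refine and_congr_left fun hx => ?_
    rw [Equiv.swap_apply_of_ne_of_ne] <;> rintro rfl <;> contradiction
  simp [htrace, hmem]

/-- If a coloring of the `k`-sets is balanced at every point of `X`, then the `k`-sets can be
permuted, without changing traces on `X`, so that it becomes balanced at one further point. -/
theorem exists_perm_trace_eq_and_balanced {ι : Type*} [Fintype ι] [DecidableEq ι] {β : ℕ}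
    (c : {T : Finset V // #T = k} → ι)
    (hsize : ∀ s, #{T | c T = s} * k = β * Fintype.card V)
    {X : Finset V} {a : V} (ha : a ∉ X) (hX : ∀ s, ∀ x ∈ X, #{T | c T = s ∧ x ∈ T.1} = β) :
    ∃ π : Equiv.Perm {T : Finset V // #T = k},
      (∀ T, (π T).1 ∩ X = T.1 ∩ X) ∧ ∀ s, #{T | c T = s ∧ a ∈ (π T).1} = β := by
  let u : {T : Finset V // #T = k} → ι ⊕ Finset V → ℕ := fun T =>
    Sum.elim (fun s => if c T = s then #(Xᶜ ∩ T.1) else 0)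
      (fun A => if T.1 ∩ X = A then #(Xᶜ \ T.1) else 0)
  let cap : ι ⊕ Finset V → ℕ := Sum.elim (fun _ => β)
    (fun A => #{T : {T : Finset V // #T = k} | T.1 ∩ X = A ∧ a ∉ T.1})
  have hN : 0 < #Xᶜ := card_pos.2 ⟨a, by simpa using ha⟩
  have row : ∀ T, ∑ p, u T p = #Xᶜ := fun T => by
    simp [u, Fintype.sum_sum_type, card_inter_add_card_sdiff]
  have colColor : ∀ s, ∑ T, u T (Sum.inl s) = #Xᶜ * β := by
    intro s
    have hin : ∑ T with c T = s, #(X ∩ T.1) = #X * β := by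
      rw [← smul_eq_mul, ← sum_const, ← sum_congr rfl (hX s)]
      simp_rw [← filter_filter, ← filter_mem_eq_inter, card_filter]
      exact sum_comm
    have hall : ∑ T with c T = s, (#(X ∩ T.1) + #(Xᶜ ∩ T.1)) = β * Fintype.card V := by
      rw [← hsize s, ← smul_eq_mul, ← sum_const]
      refine sum_congr rfl fun T _ => ?_
      rw [inter_comm X, inter_comm Xᶜ, ← sdiff_eq_inter_compl, card_inter_add_card_sdiff, T.2]
    rw [sum_add_distrib, hin, ← card_add_card_compl X] at hall
    simp only [u, Sum.elim_inl, ← sum_filter]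
    linarith
  have colTrace : ∀ A, ∑ T, u T (Sum.inr A) = #Xᶜ * cap (Sum.inr A) := by
    intro A
    simp only [u, cap, Sum.elim_inr]
    rw [← smul_eq_mul, ← sum_const, ← sum_congr rfl fun y hy =>
      card_filter_trace_notMem_eq (k := k) X A ha (mem_compl.1 hy)]
    simp_rw [← filter_notMem_eq_sdiff, card_filter]
    rw [sum_comm]
    refine sum_congr rfl fun T _ => ?_
    split_ifs with hT <;> simp [hT]
  obtain ⟨f, hf, hcap⟩ := exists_assignment_of_row_sum_col_sum u cap hN row
    (Sum.rec colColor colTrace)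
  have hfl : ∀ T s, f T = Sum.inl s → c T = s := fun T s h => by
    have := hf T
    rw [h] at this
    by_contra hne
    exact this (by simp [u, hne])
  have hfr : ∀ T A, f T = Sum.inr A → T.1 ∩ X = A := fun T A h => by
    have := hf T
    rw [h] at this
    by_contra hne
    exact this (by simp [u, hne])
  have hout : ∀ A, #{T | T.1 ∩ X = A ∧ ¬ (f T).isLeft}
      = #{T : {T : Finset V // #T = k} | T.1 ∩ X = A ∧ a ∉ T.1} := by
    intro A
    rw [show #{T : {T : Finset V // #T = k} | T.1 ∩ X = A ∧ a ∉ T.1} = _ from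
      (hcap (Sum.inr A)).symm]
    congr 1
    ext T
    rcases h : f T with s | A'
    · simp [h]
    · simp [h, hfr T A' h]
  have hin : ∀ A, #{T | T.1 ∩ X = A ∧ (f T).isLeft}
      = #{T : {T : Finset V // #T = k} | T.1 ∩ X = A ∧ a ∈ T.1} := by
    intro A
    have h1 := card_filter_add_card_filter_not
      (s := {T : {T : Finset V // #T = k} | T.1 ∩ X = A}) (fun T => (f T).isLeft)
    have h2 := card_filter_add_card_filter_not
      (s := {T : {T : Finset V // #T = k} | T.1 ∩ X = A}) (fun T => a ∈ T.1)
    simp only [filter_filter] at h1 h2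
    have := hout A
    omega
  obtain ⟨π, hπ⟩ := exists_perm_of_card_fiber_eq
    (fun T : {T : Finset V // #T = k} => (T.1 ∩ X, (f T).isLeft))
    (fun T => (T.1 ∩ X, decide (a ∈ T.1))) (by
      rintro ⟨A, _ | _⟩
      · simpa using hout A
      · simpa using hin A)
  simp only [Prod.mk.injEq] at hπ
  refine ⟨π, fun T => (hπ T).1, fun s => ?_⟩
  rw [← show #{T | f T = Sum.inl s} = β from hcap (Sum.inl s)]
  congr 1
  ext T
  have hT : a ∈ (π T).1 ↔ (f T).isLeft := by rw [← (hπ T).2]; simp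
  rcases h : f T with s' | A
  · simp [hT, h, hfl T s' h]
  · simp [hT, h]

/-- Extension of **Baranyai's theorem**: the complete `k`-uniform hypergraph has a decomposition
into `β`-factors with any admissible number of edges. -/
theorem exists_balanced_coloring {ι : Type*} [Fintype ι] [DecidableEq ι] {β b : ℕ}
    (hb : b * k = β * Fintype.card V)
    (hcard : (Fintype.card V).choose k = Fintype.card ι * b) :
    ∃ c : {T : Finset V // #T = k} → ι,
      (∀ s, #{T | c T = s} = b) ∧ ∀ s x, #{T | c T = s ∧ x ∈ T.1} = β := by
  suffices ∀ X : Finset V, ∃ c : {T : Finset V // #T = k} → ι,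
      (∀ s, #{T | c T = s} = b) ∧ ∀ s, ∀ x ∈ X, #{T | c T = s ∧ x ∈ T.1} = β by
    simpa using this univ
  intro X
  induction X using Finset.induction_on with
  | empty =>
    have e : {T : Finset V // #T = k} ≃ ι × Fin b :=
      Fintype.equivOfCardEq (by simp [hcard])
    refine ⟨fun T => (e T).1, fun s => ?_, by simp⟩
    rw [card_equiv (t := {s} ×ˢ univ) e fun T => by rw [mem_filter, mem_product]; simp]
    simp
  | insert a X ha ih =>
    obtain ⟨c, hc, hX⟩ := ih
    obtain ⟨π, htrace, hπ⟩ :=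
      exists_perm_trace_eq_and_balanced c (fun s => by rw [hc, hb]) ha hX
    refine ⟨fun T => c (π.symm T), fun s => ?_, fun s x hx => ?_⟩
    · rw [← hc s]
      exact card_equiv π.symm (by simp)
    · have hperm : #{T | c (π.symm T) = s ∧ x ∈ T.1} = #{T | c T = s ∧ x ∈ (π T).1} :=
        card_equiv π.symm (by simp)
      rw [hperm]
      rcases mem_insert.1 hx with rfl | hx
      · exact hπ s
      · rw [← hX s x hx]
        congr 1
        ext T
        have := congrArg (x ∈ ·) (htrace T)
        simp only [mem_inter, hx, and_true, eq_iff_iff] at this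
        simp [this]

end Baranyai

/-- `n / gcd n (t + 1)` divides `n.choose (t + 1)`. -/
theorem div_gcd_dvd_choose (n t : ℕ) : n / n.gcd (t + 1) ∣ n.choose (t + 1) := by
  rcases n with _ | n
  · simp
  have hg : 0 < (n + 1).gcd (t + 1) := Nat.gcd_pos_of_pos_left _ n.succ_pos
  refine (Nat.coprime_div_gcd_div_gcd hg).dvd_of_dvd_mul_right
    (Dvd.intro (n.choose t) (Nat.eq_of_mul_eq_mul_left hg ?_))
  rw [← mul_assoc, Nat.mul_div_cancel' (Nat.gcd_dvd_left _ _), mul_left_comm,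
    Nat.mul_div_cancel' (Nat.gcd_dvd_right _ _)]
  exact Nat.add_one_mul_choose_eq n t

/-- Theorem 2 (base scheduling) of the paper: the family of all `(t+1)`-element
subsets of `Fin Ω` can be partitioned into `S₀ = C(Ω, t+1) / B₀` pairwise disjoint
subfamilies, each containing exactly `B₀ = Ω / gcd(Ω, t+1)` sets, such that every
element of the ground set belongs to exactly `β₀ = (t+1) / gcd(Ω, t+1)` of the sets
in each subfamily. -/
theorem stmt_2 (t Ω : ℕ) (h : t + 1 ≤ Ω) :
    ∃ P : Fin (Nat.choose Ω (t + 1) / (Ω / Nat.gcd Ω (t + 1))) →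
        Finset (Finset (Fin Ω)),
      (∀ s s', s ≠ s' → Disjoint (P s) (P s')) ∧
      (Finset.univ.biUnion P = Finset.powersetCard (t + 1) Finset.univ) ∧
      (∀ s, (P s).card = Ω / Nat.gcd Ω (t + 1)) ∧
      (∀ s (x : Fin Ω), ((P s).filter (fun T => x ∈ T)).card
          = (t + 1) / Nat.gcd Ω (t + 1)) := by
  have hg : 0 < Ω.gcd (t + 1) := Nat.gcd_pos_of_pos_right _ t.succ_pos
  have hb : Ω / Ω.gcd (t + 1) * (t + 1) = (t + 1) / Ω.gcd (t + 1) * Fintype.card (Fin Ω) := by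
    rw [Fintype.card_fin, Nat.div_mul_right_comm (Nat.gcd_dvd_left _ _),
      Nat.div_mul_right_comm (Nat.gcd_dvd_right _ _), mul_comm]
  obtain ⟨c, hc, hx⟩ := exists_balanced_coloring
    (ι := Fin (Ω.choose (t + 1) / (Ω / Ω.gcd (t + 1)))) hb
    (by simp [Nat.div_mul_cancel (div_gcd_dvd_choose Ω t)])
  refine ⟨fun s => ({T | c T = s} : Finset _).map (Function.Embedding.subtype _), ?_, ?_, ?_, ?_⟩
  · intro s s' hs
    rw [disjoint_map]
    exact disjoint_filter.2 fun T _ h h' => hs (h.symm.trans h')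
  · ext T
    simp [mem_powersetCard]
  · simpa using hc
  · intro s x
    rw [filter_map, card_map, filter_filter]
    exact hx s x
end

section
/- Let t and Ω be natural numbers with t + 1 ≥ 1 and (t+1) dividing Ω. Then the family of all (t+1)-element subsets of a ground set with Ω elements (e.g., Fin Ω) can be partitioned into C(Ω−1, t) pairwise disjoint subfamilies, each of which consists of exactly Ω/(t+1) pairwise disjoint sets whose union is the entire ground set. -/
open Finset

/-- An integral selection from a fractional one: if the weights `w` of the entries of every row of
`A` sum to `q > 0`, and the total weight of the occurrences of each symbol `S` is `q * cap S`, then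
one can pick an entry in every row such that each symbol `S` is picked exactly `cap S` times. -/
theorem exists_selection_of_weights {ι κ σ : Type*} [Fintype ι] [Fintype κ] [Fintype σ]
    [DecidableEq σ] (A : ι → κ → σ) (w cap : σ → ℕ) {q : ℕ} (hq : 0 < q)
    (hrow : ∀ i, ∑ j, w (A i j) = q)
    (hcap : ∀ S, #{p : ι × κ | A p.1 p.2 = S} * w S = q * cap S) :
    ∃ φ : ι → κ, ∀ S, #{i | A i (φ i) = S} = cap S := by
  classical
  have sum_weight_eq (N : Finset σ) :
      ∑ p : ι × κ with A p.1 p.2 ∈ N, w (A p.1 p.2) = q * ∑ S ∈ N, cap S := by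
    rw [mul_sum, ← sum_fiberwise_of_maps_to (g := fun p : ι × κ => A p.1 p.2) (t := N)
      (fun p hp => (mem_filter.1 hp).2)]
    refine sum_congr rfl fun S hS => ?_
    rw [← hcap S, filter_filter, ← smul_eq_mul, ← sum_const]
    refine sum_congr ?_ ?_
    · ext p
      simp only [mem_filter, mem_univ, true_and]
      exact ⟨fun h => h.2, fun h => ⟨h ▸ hS, h⟩⟩
    · intro p hp
      rw [(mem_filter.1 hp).2]
  have total : ∑ S, cap S = Fintype.card ι := by
    have h := sum_weight_eq univ
    simp only [mem_univ, filter_true, Fintype.sum_prod_type, hrow, sum_const, smul_eq_mul,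
      card_univ] at h
    rw [mul_comm] at h
    exact (Nat.eq_of_mul_eq_mul_left hq h).symm
  have hall : ∀ X : Finset ι, #X ≤ #(X.biUnion fun i =>
      (univ.image (A i)).sigma fun S => (univ : Finset (Fin (cap S)))) := by
    intro X
    have hU : (X.biUnion fun i => (univ.image (A i)).sigma fun S => (univ : Finset (Fin (cap S))))
        = (X.biUnion fun i => univ.image (A i)).sigma fun S => univ := by
      ext ⟨S, c⟩
      simp
    rw [hU, card_sigma]
    simp only [card_univ, Fintype.card_fin]
    refine Nat.le_of_mul_le_mul_left ?_ hq
    rw [← sum_weight_eq]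
    calc q * #X = ∑ i ∈ X, ∑ j, w (A i j) := by simp [hrow, mul_comm]
      _ = ∑ p ∈ X ×ˢ univ, w (A p.1 p.2) := by rw [sum_product]
      _ ≤ _ := by
        refine sum_le_sum_of_subset fun p hp => ?_
        simp only [mem_product, mem_univ, and_true] at hp
        simp only [mem_filter, mem_univ, true_and, mem_biUnion, mem_image]
        exact ⟨p.1, hp, p.2, rfl⟩
  obtain ⟨f, hf, hfA⟩ := (all_card_le_biUnion_card_iff_exists_injective _).1 hall
  have hφ : ∀ i, ∃ j, A i j = (f i).1 := by
    intro i
    simpa using hfA i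
  choose φ hφ using hφ
  refine ⟨φ, ?_⟩
  have hbij : Function.Bijective f := by
    rw [Fintype.bijective_iff_injective_and_card]
    exact ⟨hf, by rw [Fintype.card_sigma]; simp only [Fintype.card_fin, total]⟩
  intro S
  simp only [hφ]
  rw [← card_map ⟨f, hf⟩]
  have : map ⟨f, hf⟩ {i | (f i).1 = S}
      = ({S} : Finset σ).sigma fun S => (univ : Finset (Fin (cap S))) := by
    ext x
    obtain ⟨i, rfl⟩ := hbij.2 x
    rw [mem_sigma, mem_singleton, and_iff_left (mem_univ _)]
    exact (mem_map' ⟨f, hf⟩).trans (by simp only [mem_filter, mem_univ, true_and])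
  rw [this, card_sigma]
  simp

/-- The number of ways to complete a set of size `s` to a set of size `k` by means of `r` further
elements. -/
def completionCount (k r s : ℕ) : ℕ := if s ≤ k then r.choose (k - s) else 0

theorem completionCount_succ (k r s : ℕ) :
    completionCount k (r + 1) s = completionCount k r s + completionCount k r (s + 1) := by
  unfold completionCount
  rcases lt_trichotomy s k with h | rfl | h
  · obtain ⟨d, rfl⟩ := Nat.exists_eq_add_of_lt h
    rw [if_pos (by omega), if_pos (by omega), if_pos (by omega),
      show s + d + 1 - s = d + 1 by omega, show s + d + 1 - (s + 1) = d by omega,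
      Nat.choose_succ_succ, add_comm]
  · simp
  · rw [if_neg (by omega), if_neg (by omega), if_neg (by omega)]

theorem completionCount_succ_mul (k r s : ℕ) :
    completionCount k (r + 1) s * (k - s) = (r + 1) * completionCount k r (s + 1) := by
  unfold completionCount
  rcases lt_trichotomy s k with h | rfl | h
  · obtain ⟨d, rfl⟩ := Nat.exists_eq_add_of_lt h
    rw [if_pos (by omega), if_pos (by omega),
      show s + d + 1 - s = d + 1 by omega, show s + d + 1 - (s + 1) = d by omega]
    exact (Nat.add_one_mul_choose_eq r d).symm
  · simp
  · rw [if_neg (by omega), if_neg (by omega)]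
    simp

/-- Baranyai's theorem for a partially processed ground set: there are maps `g i : α → κ` such that
among the traces on `U` of all their fibres, each `S ⊆ U` occurs as often as it is the trace
of a `k`-element subset of `α`. -/
theorem exists_colorings_card_fiber_eq {α ι κ : Type*} [Fintype α] [DecidableEq α] [Fintype ι]
    [Fintype κ] [DecidableEq κ] {k : ℕ} (hα : Fintype.card κ * k = Fintype.card α)
    (hι : Fintype.card ι * Fintype.card κ = (Fintype.card α).choose k) (U : Finset α) :
    ∃ g : ι → α → κ, ∀ S ⊆ U,
      #{p : ι × κ | {x ∈ U | g p.1 x = p.2} = S} = completionCount k #Uᶜ #S := by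
  induction U using Finset.induction_on with
  | empty =>
    have hne : Nonempty (α → κ) := by
      rcases isEmpty_or_nonempty κ with h | h
      · have : IsEmpty α := by
          rw [← Fintype.card_eq_zero_iff, ← hα, Fintype.card_eq_zero, zero_mul]
        exact ⟨isEmptyElim⟩
      · exact inferInstance
    obtain ⟨g⟩ := hne
    refine ⟨fun _ => g, fun S hS => ?_⟩
    obtain rfl := subset_empty.1 hS
    simp [completionCount, hι, card_univ]
  | insert a U ha ih =>
    obtain ⟨g, hg⟩ := ih
    obtain ⟨r, hr⟩ : ∃ r, #Uᶜ = r + 1 :=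
      Nat.exists_eq_succ_of_ne_zero (card_ne_zero_of_mem (mem_compl.2 ha))
    have hr' : #(insert a U)ᶜ = r := by
      rw [compl_insert, card_erase_of_mem (mem_compl.2 ha), hr, Nat.add_sub_cancel]
    rw [hr] at hg
    rw [hr']
    have hle : ∀ i j, #{x ∈ U | g i x = j} ≤ k := by
      intro i j
      by_contra hlt
      have h := hg {x ∈ U | g i x = j} (filter_subset _ _)
      rw [completionCount, if_neg hlt] at h
      exact (card_ne_zero_of_mem (a := (i, j)) (by simp)) h
    obtain ⟨φ, hφ⟩ := exists_selection_of_weights (fun i j => {x ∈ U | g i x = j})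
      (fun S => k - #S) (fun S => if S ⊆ U then completionCount k r (#S + 1) else 0)
      (Nat.succ_pos r) (by
        intro i
        have h1 : ∑ j, (k - #{x ∈ U | g i x = j}) + ∑ j, #{x ∈ U | g i x = j}
            = Fintype.card κ * k := by
          rw [← sum_add_distrib, sum_congr rfl fun j _ => Nat.sub_add_cancel (hle i j)]
          simp
        rw [← card_eq_sum_card_fiberwise (fun x _ => mem_coe.2 (mem_univ (g i x))), hα,
          ← card_add_card_compl U, hr] at h1
        omega) (by
        intro S
        split_ifs with hS
        · rw [hg S hS, completionCount_succ_mul]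
        · rw [mul_zero, card_eq_zero.2, zero_mul]
          refine filter_eq_empty_iff.2 fun p _ h => hS ?_
          rw [← h]
          exact filter_subset _ _)
    have hfib (p : ι × κ) : {x ∈ insert a U | Function.update (g p.1) a (φ p.1) x = p.2}
        = if φ p.1 = p.2 then insert a {x ∈ U | g p.1 x = p.2} else {x ∈ U | g p.1 x = p.2} := by
      have h : {x ∈ U | Function.update (g p.1) a (φ p.1) x = p.2} = {x ∈ U | g p.1 x = p.2} :=
        filter_congr fun x hx => by
          rw [Function.update_of_ne (ne_of_mem_of_not_mem hx ha)]
      rw [filter_insert, h, Function.update_self]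
    have hdiag (T : Finset α) (hT : T ⊆ U) :
        #{p : ι × κ | φ p.1 = p.2 ∧ {x ∈ U | g p.1 x = p.2} = T}
          = completionCount k r (#T + 1) := by
      rw [← (hφ T).trans (if_pos hT)]
      symm
      refine card_bij (fun i _ => (i, φ i)) ?_ ?_ ?_
      · simp
      · intro i _ j _ h
        exact congrArg Prod.fst h
      · rintro ⟨i, j⟩ h
        simp only [mem_filter, mem_univ, true_and] at h
        obtain ⟨rfl, h⟩ := h
        exact ⟨i, by simpa using h, rfl⟩
    refine ⟨fun i => Function.update (g i) a (φ i), fun S hS => ?_⟩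
    simp only [hfib]
    by_cases haS : a ∈ S
    · have hT : S.erase a ⊆ U := subset_insert_iff.1 hS
      rw [← card_erase_add_one haS, ← hdiag _ hT]
      congr 1
      refine filter_congr fun p _ => ?_
      have hap : a ∉ ({x ∈ U | g p.1 x = p.2} : Finset α) := fun h => ha (mem_filter.1 h).1
      split_ifs with h
      · simp only [h, true_and]
        constructor
        · rintro rfl
          rw [erase_insert hap]
        · intro h
          rw [h, insert_erase haS]
      · simp only [h, false_and, iff_false]
        rintro rfl
        exact hap haS
    · have hT : S ⊆ U := (subset_insert_iff_of_notMem haS).1 hS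
      have h1 := hg S hT
      rw [completionCount_succ, ← hdiag S hT,
        ← card_filter_add_card_filter_not (fun p : ι × κ => φ p.1 = p.2), filter_filter,
        filter_filter, add_comm] at h1
      simp only [and_comm (b := φ _ = _)] at h1
      rw [← Nat.add_right_cancel h1]
      congr 1
      refine filter_congr fun p _ => ?_
      split_ifs with h
      · simp only [h, not_true_eq_false, and_false, iff_false]
        rintro rfl
        exact haS (mem_insert_self _ _)
      · simp [h]

/-- Baranyai's theorem (the special case `β₀ = 1` of the paper's Theorem 2):
if `(t+1) ∣ Ω`, the family of all `(t+1)`-element subsets of `Fin Ω` can be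
partitioned into `C(Ω−1, t)` pairwise disjoint subfamilies, each consisting of
exactly `Ω / (t+1)` pairwise disjoint sets whose union is the entire ground set. -/
theorem stmt_3 (t Ω : ℕ) (h1 : 1 ≤ t + 1) (hdvd : (t + 1) ∣ Ω) :
    ∃ P : Fin (Nat.choose (Ω - 1) t) → Finset (Finset (Fin Ω)),
      (∀ s s', s ≠ s' → Disjoint (P s) (P s')) ∧
      (Finset.univ.biUnion P = Finset.powersetCard (t + 1) Finset.univ) ∧
      (∀ s, (P s).card = Ω / (t + 1)) ∧
      (∀ s, ∀ T ∈ P s, ∀ T' ∈ P s, T ≠ T' → Disjoint T T') ∧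
      (∀ s, (P s).biUnion (fun T => T) = (Finset.univ : Finset (Fin Ω))) := by
  have hm : Ω / (t + 1) * (t + 1) = Ω := Nat.div_mul_cancel hdvd
  have hι : (Ω - 1).choose t * (Ω / (t + 1)) = Ω.choose (t + 1) := by
    refine Nat.eq_of_mul_eq_mul_right h1 ?_
    rw [mul_assoc, hm]
    rcases Ω with _ | n
    · simp
    · rw [← Nat.add_one_mul_choose_eq, Nat.add_sub_cancel, mul_comm]
  obtain ⟨g, hg⟩ := exists_colorings_card_fiber_eq (α := Fin Ω)
    (ι := Fin ((Ω - 1).choose t)) (κ := Fin (Ω / (t + 1))) (k := t + 1)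
    (by simpa using hm) (by simpa using hι) univ
  set F : Fin ((Ω - 1).choose t) × Fin (Ω / (t + 1)) → Finset (Fin Ω) :=
    fun p => {x | g p.1 x = p.2} with hF
  have hcount (S : Finset (Fin Ω)) : #{p | F p = S} = if #S = t + 1 then 1 else 0 := by
    rw [hg S (subset_univ S), compl_univ, card_empty, completionCount]
    split_ifs with h h' h'
    · simp [h']
    · exact Nat.choose_eq_zero_of_lt (by omega)
    · omega
    · rfl
  have hcard (p) : #(F p) = t + 1 := by
    by_contra h
    have := hcount (F p)
    rw [if_neg h] at this
    exact card_ne_zero_of_mem (a := p) (by simp) this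
  have hinj : Function.Injective F := by
    intro p p' h
    have := hcount (F p)
    rw [if_pos (hcard p)] at this
    exact card_le_one.1 this.le p (by simp) p' (by simp [h])
  refine ⟨fun i => univ.image fun j => F (i, j), ?_, ?_, ?_, ?_, ?_⟩
  · intro s s' hs
    rw [disjoint_left]
    intro T hT hT'
    obtain ⟨j, -, rfl⟩ := mem_image.1 hT
    obtain ⟨j', -, h⟩ := mem_image.1 hT'
    exact hs (congrArg Prod.fst (hinj h)).symm
  · ext S
    simp only [mem_biUnion, mem_univ, true_and, mem_image, mem_powersetCard_univ]
    constructor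
    · rintro ⟨i, j, rfl⟩
      exact hcard _
    · intro hS
      have := hcount S
      rw [if_pos hS] at this
      obtain ⟨⟨i, j⟩, hp⟩ := card_pos.1 (this ▸ Nat.one_pos)
      exact ⟨i, j, (mem_filter.1 hp).2⟩
  · intro s
    rw [card_image_of_injective _ fun j j' h => congrArg Prod.snd (hinj h)]
    simp
  · intro s T hT T' hT' hne
    obtain ⟨j, -, rfl⟩ := mem_image.1 hT
    obtain ⟨j', -, rfl⟩ := mem_image.1 hT'
    rw [disjoint_left]
    intro x hx hx'
    simp only [hF, mem_filter, mem_univ, true_and] at hx hx'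
    exact hne (by rw [← hx, ← hx'])
  · intro s
    ext x
    simp [hF]
end
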